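/- arXiv:1111.2325 — 2 statements merged into one kernel-verified Lean document; each statement's English description precedes it below -/
import Mathlib

section
/- (One-particle Morawetz identity for NLS.) Let a : ℝⁿ → ℝ be smooth with all derivatives of at most polynomial growth, and define the Morawetz action M₀(t) = ∫_{ℝⁿ} ∇a(x) · p⃗(t,x) dx. Then for every t, d/dt M₀(t) = ∫_{ℝⁿ} Δa(x) ( −(1/2) Δρ(t,x) + λ ((p−1)/(p+1)) |u(t,x)|^{p+1} ) dx + 2 ∫_{ℝⁿ} Σ_{j,k} (∂_j∂_k a(x)) Re( ∂_{x_j}ū(t,x) ∂_{x_k}u(t,x) ) dx. -/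
open MeasureTheory Complex
open scoped FourierTransform

noncomputable section

/-- Euclidean space `ℝⁿ`. -/
abbrev En (n : ℕ) := EuclideanSpace ℝ (Fin n)

/-- Partial derivative `∂_{x_j} f` of a complex-valued function. -/
noncomputable def pd {n : ℕ} (j : Fin n) (f : En n → ℂ) (x : En n) : ℂ :=
  fderiv ℝ f x (EuclideanSpace.single j 1)

/-- Laplacian `Δf` of a complex-valued function. -/
noncomputable def lap {n : ℕ} (f : En n → ℂ) (x : En n) : ℂ := ∑ j, pd j (pd j f) x

/-- Partial derivative `∂_{x_j} f` of a real-valued function. -/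
noncomputable def rpd {n : ℕ} (j : Fin n) (f : En n → ℝ) (x : En n) : ℝ :=
  fderiv ℝ f x (EuclideanSpace.single j 1)

/-- Laplacian `Δf` of a real-valued function. -/
noncomputable def rlap {n : ℕ} (f : En n → ℝ) (x : En n) : ℝ := ∑ j, rpd j (rpd j f) x

/-- `u : ℝ × ℝⁿ → ℂ` is a smooth solution of the NLS `i∂ₜu + Δu = λ|u|^{p-1}u`,
Schwartz class in `x` locally uniformly in `t`. -/
structure NLSSolution (n : ℕ) (p lam : ℝ) (u : ℝ → En n → ℂ) : Prop where
  smooth : ContDiff ℝ (⊤ : ℕ∞) (fun q : ℝ × En n => u q.1 q.2)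
  decay : ∀ (k N : ℕ) (T : ℝ), ∃ C : ℝ, ∀ t : ℝ, |t| ≤ T → ∀ x : En n,
      ‖x‖ ^ N * ‖iteratedFDeriv ℝ k (u t) x‖ ≤ C
  eq : ∀ (t : ℝ) (x : En n),
      Complex.I * deriv (fun s => u s x) t + lap (u t) x
        = (lam : ℂ) * ((‖u t x‖ ^ (p - 1) : ℝ) : ℂ) * u t x

/-- The momentum density `p_j = Im(ū ∂_{x_j} u)`. -/
noncomputable def mom {n : ℕ} (u : ℝ → En n → ℂ) (j : Fin n) (t : ℝ) (x : En n) : ℝ :=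
  (starRingEnd ℂ (u t x) * pd j (u t) x).im

/-- The Morawetz action centered at `y`:
`M_y(t) = ∫ ((x-y)/|x-y|) · Im(ū ∇u)(t,x) dx`. -/
noncomputable def morAction {n : ℕ} (u : ℝ → En n → ℂ) (y : En n) (t : ℝ) : ℝ :=
  ∫ x : En n, ∑ j, ((x j - y j) / ‖x - y‖) * mom u j t x

/-! ### Rapid decay and polynomial growth, uniformly in a parameter -/

/-- Rapid decay in `x`, uniformly for `t ∈ S`. -/
def RapDec {n : ℕ} {E : Type*} [NormedAddCommGroup E] (S : Set ℝ) (g : ℝ → En n → E) : Prop :=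
  ∀ N : ℕ, ∃ C : ℝ, ∀ t ∈ S, ∀ x : En n, (1 + ‖x‖) ^ N * ‖g t x‖ ≤ C

/-- Polynomial growth in `x`, uniformly for `t ∈ S`. -/
def PolGr {n : ℕ} {E : Type*} [NormedAddCommGroup E] (S : Set ℝ) (g : ℝ → En n → E) : Prop :=
  ∃ C : ℝ, ∃ m : ℕ, ∀ t ∈ S, ∀ x : En n, ‖g t x‖ ≤ C * (1 + ‖x‖) ^ m

section decay
variable {n : ℕ} {E F G : Type*} [NormedAddCommGroup E] [NormedAddCommGroup F]
  [NormedAddCommGroup G] {S : Set ℝ}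

lemma RapDec.polGr {g : ℝ → En n → E} (h : RapDec S g) : PolGr S g := by
  obtain ⟨C, hC⟩ := h 0
  exact ⟨C, 0, fun t ht x => by simpa using hC t ht x⟩

lemma RapDec.of_le {g : ℝ → En n → E} {h : ℝ → En n → F} {k : ℝ → En n → G}
    (hg : RapDec S g) (hh : PolGr S h)
    (hk : ∀ t x, ‖k t x‖ ≤ ‖h t x‖ * ‖g t x‖) : RapDec S k := by
  intro N
  obtain ⟨C, m, hC⟩ := hh
  obtain ⟨D, hD⟩ := hg (N + m)
  refine ⟨|C| * D, fun t ht x => ?_⟩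
  have h0 : (0 : ℝ) ≤ (1 + ‖x‖) ^ N := by positivity
  calc (1 + ‖x‖) ^ N * ‖k t x‖ ≤ (1 + ‖x‖) ^ N * (‖h t x‖ * ‖g t x‖) := by
        gcongr; exact hk t x
    _ ≤ (1 + ‖x‖) ^ N * ((|C| * (1 + ‖x‖) ^ m) * ‖g t x‖) := by
        gcongr
        exact (hC t ht x).trans (by gcongr; exact le_abs_self C)
    _ = |C| * ((1 + ‖x‖) ^ (N + m) * ‖g t x‖) := by ring
    _ ≤ |C| * D := by gcongr; exact hD t ht x

lemma RapDec.add {g h : ℝ → En n → E} (hg : RapDec S g) (hh : RapDec S h) :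
    RapDec S (fun t x => g t x + h t x) := by
  intro N
  obtain ⟨C, hC⟩ := hg N
  obtain ⟨D, hD⟩ := hh N
  refine ⟨C + D, fun t ht x => ?_⟩
  calc (1 + ‖x‖) ^ N * ‖g t x + h t x‖ ≤ (1 + ‖x‖) ^ N * (‖g t x‖ + ‖h t x‖) := by
        gcongr; exact norm_add_le _ _
    _ = (1 + ‖x‖) ^ N * ‖g t x‖ + (1 + ‖x‖) ^ N * ‖h t x‖ := by ring
    _ ≤ C + D := add_le_add (hC t ht x) (hD t ht x)

lemma RapDec.neg {g : ℝ → En n → E} (hg : RapDec S g) : RapDec S (fun t x => - g t x) := by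
  intro N
  obtain ⟨C, hC⟩ := hg N
  exact ⟨C, fun t ht x => by simpa using hC t ht x⟩

lemma RapDec.sub {g h : ℝ → En n → E} (hg : RapDec S g) (hh : RapDec S h) :
    RapDec S (fun t x => g t x - h t x) := by
  simpa [sub_eq_add_neg] using hg.add hh.neg

lemma RapDec.sum {ι : Type*} (s : Finset ι) {g : ι → ℝ → En n → E} (hg : ∀ i, RapDec S (g i)) :
    RapDec S (fun t x => ∑ i ∈ s, g i t x) := by
  classical
  induction s using Finset.induction_on with
  | empty => intro N; exact ⟨0, fun t _ x => by simp⟩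
  | insert i s hi ih => simpa [Finset.sum_insert hi] using (hg i).add ih

lemma PolGr.const (c : E) : PolGr S (fun _ (_ : En n) => c) :=
  ⟨‖c‖, 0, fun t _ x => by simp⟩

lemma RapDec.const_mul {g : ℝ → En n → ℝ} (hg : RapDec S g) (c : ℝ) :
    RapDec S (fun t x => c * g t x) :=
  hg.of_le (PolGr.const c) (fun _ _ => (norm_mul _ _).le)

lemma RapDec.mulL {g : ℝ → En n → ℝ} {h : ℝ → En n → ℝ} (hg : RapDec S g) (hh : PolGr S h) :
    RapDec S (fun t x => h t x * g t x) :=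
  hg.of_le hh (fun _ _ => (norm_mul _ _).le)

lemma RapDec.re {g h : ℝ → En n → ℂ} (hg : RapDec S g) (hh : RapDec S h) :
    RapDec S (fun t x => (starRingEnd ℂ (g t x) * h t x).re) :=
  hh.of_le hg.polGr (fun t x => by
    refine (Complex.abs_re_le_norm _).trans ?_
    simp)

lemma RapDec.im {g h : ℝ → En n → ℂ} (hg : RapDec S g) (hh : RapDec S h) :
    RapDec S (fun t x => (starRingEnd ℂ (g t x) * h t x).im) :=
  hh.of_le hg.polGr (fun t x => by
    refine (Complex.abs_im_le_norm _).trans ?_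
    simp)

lemma RapDec.rpow_polGr {g : ℝ → En n → E} (hg : RapDec S g) {q : ℝ} (hq : 0 ≤ q) :
    PolGr S (fun t x => ‖g t x‖ ^ q) := by
  obtain ⟨C, hC⟩ := hg 0
  refine ⟨C ^ q, 0, fun t ht x => ?_⟩
  have h := hC t ht x
  simp only [pow_zero, one_mul, mul_one] at h ⊢
  rw [Real.norm_of_nonneg (by positivity)]
  exact Real.rpow_le_rpow (norm_nonneg _) h hq

lemma RapDec.rpow {g : ℝ → En n → E} (hg : RapDec S g) {q : ℝ} (hq : 1 ≤ q) :
    RapDec S (fun t x => ‖g t x‖ ^ q) := by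
  refine hg.of_le (hg.rpow_polGr (q := q - 1) (by linarith)) (fun t x => ?_)
  rw [Real.norm_of_nonneg (by positivity), Real.norm_of_nonneg (by positivity)]
  rcases eq_or_lt_of_le (norm_nonneg (g t x)) with h | h
  · rw [← h, Real.zero_rpow (by linarith)]; simp
  · rw [Real.rpow_sub_one h.ne']; field_simp; exact le_rfl

lemma integrable_bound (n : ℕ) :
    Integrable (fun x : En n => ((1 + ‖x‖) ^ (n + 1))⁻¹) := by
  have := integrable_one_add_norm (E := En n) (μ := volume) (r := ((n + 1 : ℕ) : ℝ)) (by
    simp)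
  refine this.congr (Filter.Eventually.of_forall fun x => ?_)
  show (1 + ‖x‖) ^ (-((n + 1 : ℕ) : ℝ)) = _
  rw [Real.rpow_neg (by positivity), Real.rpow_natCast]

lemma RapDec.bound {g : ℝ → En n → E} (hg : RapDec S g) :
    ∃ C : ℝ, ∀ t ∈ S, ∀ x : En n, ‖g t x‖ ≤ C * ((1 + ‖x‖) ^ (n + 1))⁻¹ := by
  obtain ⟨C, hC⟩ := hg (n + 1)
  refine ⟨C, fun t ht x => ?_⟩
  rw [← div_eq_mul_inv, le_div_iff₀ (by positivity), mul_comm]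
  exact hC t ht x

lemma RapDec.integrable {g : ℝ → En n → E} (hg : RapDec S g) {t : ℝ} (ht : t ∈ S)
    (hc : Continuous (g t)) : Integrable (g t) := by
  obtain ⟨C, hC⟩ := hg.bound
  exact ((integrable_bound n).const_mul C).mono' hc.aestronglyMeasurable
    (Filter.Eventually.of_forall (hC t ht))

end decay

/-! ### Derivatives -/

section derivs
variable {n : ℕ} {E : Type*} [NormedAddCommGroup E] [NormedSpace ℝ E]

lemma contDiff_dir {V : Type*} [NormedAddCommGroup V] [NormedSpace ℝ V]
    {f : V → E} (hf : ContDiff ℝ (⊤ : ℕ∞) f) (v : V) :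
    ContDiff ℝ (⊤ : ℕ∞) (fun x => fderiv ℝ f x v) :=
  (contDiff_infty_iff_fderiv.1 hf).2.clm_apply contDiff_const

lemma norm_iter_dir {f : En n → E} (hf : ContDiff ℝ (⊤ : ℕ∞) f) (j : Fin n) (k : ℕ) (x : En n) :
    ‖iteratedFDeriv ℝ k (fun x => fderiv ℝ f x (EuclideanSpace.single j 1)) x‖
      ≤ ‖iteratedFDeriv ℝ (k + 1) f x‖ := by
  rw [← norm_iteratedFDeriv_fderiv]
  have h := (ContinuousLinearMap.apply ℝ E (EuclideanSpace.single j (1 : ℝ))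
    : (En n →L[ℝ] E) →L[ℝ] E).norm_iteratedFDeriv_comp_left (n := k) (x := x) (N := (⊤ : ℕ∞))
    (contDiff_infty_iff_fderiv.1 hf).2.contDiffAt (by exact_mod_cast le_top)
  refine h.trans ?_
  have h1 : ‖(ContinuousLinearMap.apply ℝ E (EuclideanSpace.single j (1 : ℝ))
    : (En n →L[ℝ] E) →L[ℝ] E)‖ ≤ 1 := by
    refine ContinuousLinearMap.opNorm_le_bound _ zero_le_one (fun L => ?_)
    have := L.le_opNorm (EuclideanSpace.single j (1 : ℝ))
    simpa using this
  exact (mul_le_mul_of_nonneg_right h1 (norm_nonneg _)).trans (one_mul _).le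

/-- all spatial derivatives decay rapidly -/
def AllDec (S : Set ℝ) (u : ℝ → En n → ℂ) : Prop :=
  (∀ t, ContDiff ℝ (⊤ : ℕ∞) (u t)) ∧ ∀ k, RapDec S (fun t x => ‖iteratedFDeriv ℝ k (u t) x‖)

lemma AllDec.pd {S : Set ℝ} {u : ℝ → En n → ℂ} (h : AllDec S u) (j : Fin n) :
    AllDec S (fun t => pd j (u t)) := by
  refine ⟨fun t => contDiff_dir (h.1 t) _, fun k => ?_⟩
  refine (h.2 (k + 1)).of_le (PolGr.const (1 : ℝ)) (fun t x => ?_)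
  simp only [norm_norm, norm_one, one_mul]
  exact norm_iter_dir (h.1 t) j k x

lemma AllDec.rapDec {S : Set ℝ} {u : ℝ → En n → ℂ} (h : AllDec S u) : RapDec S u := by
  refine (h.2 0).of_le (PolGr.const (1 : ℝ)) (fun t x => ?_)
  simp

lemma lap_contDiff {f : En n → ℂ} (hf : ContDiff ℝ (⊤ : ℕ∞) f) :
    ContDiff ℝ (⊤ : ℕ∞) (lap f) := by
  unfold lap
  exact ContDiff.sum fun j _ => contDiff_dir (contDiff_dir hf _) _

lemma pd_contDiff {f : En n → ℂ} (hf : ContDiff ℝ (⊤ : ℕ∞) f) (j : Fin n) :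
    ContDiff ℝ (⊤ : ℕ∞) (pd j f) := contDiff_dir hf _

lemma rpd_contDiff {f : En n → ℝ} (hf : ContDiff ℝ (⊤ : ℕ∞) f) (j : Fin n) :
    ContDiff ℝ (⊤ : ℕ∞) (rpd j f) := contDiff_dir hf _

lemma pd_line {f : En n → ℂ} (hf : ContDiff ℝ (⊤ : ℕ∞) f) (j : Fin n) (x : En n) :
    HasLineDerivAt ℝ f (pd j f x) x (EuclideanSpace.single j 1) :=
  ((hf.differentiable (by simp)) x).hasFDerivAt.hasLineDerivAt _

lemma rpd_line {f : En n → ℝ} (hf : ContDiff ℝ (⊤ : ℕ∞) f) (j : Fin n) (x : En n) :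
    HasLineDerivAt ℝ f (rpd j f x) x (EuclideanSpace.single j 1) :=
  ((hf.differentiable (by simp)) x).hasFDerivAt.hasLineDerivAt _

lemma dir_symm {V : Type*} [NormedAddCommGroup V] [NormedSpace ℝ V]
    {f : V → E} (hf : ContDiff ℝ (⊤ : ℕ∞) f) (v w x : V) :
    fderiv ℝ (fun y => fderiv ℝ f y v) x w = fderiv ℝ (fun y => fderiv ℝ f y w) x v := by
  have hs : IsSymmSndFDerivAt ℝ f x := hf.contDiffAt.isSymmSndFDerivAt (by
    simp only [minSmoothness_of_isRCLikeNormedField]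
    exact (WithTop.coe_le_coe.2 le_top : ((2 : ℕ∞) : WithTop ℕ∞) ≤ _))
  have hd : DifferentiableAt ℝ (fderiv ℝ f) x :=
    ((contDiff_infty_iff_fderiv.1 hf).2.differentiable (by simp)) x
  rw [fderiv_clm_apply hd (differentiableAt_const _), fderiv_clm_apply hd (differentiableAt_const _)]
  simpa using hs w v

lemma pd_symm {f : En n → ℂ} (hf : ContDiff ℝ (⊤ : ℕ∞) f) (j k : Fin n) (x : En n) :
    pd j (pd k f) x = pd k (pd j f) x := dir_symm hf _ _ x

lemma pd_lap {f : En n → ℂ} (hf : ContDiff ℝ (⊤ : ℕ∞) f) (k : Fin n) (x : En n) :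
    pd k (lap f) x = ∑ j, pd k (pd j (pd j f)) x := by
  unfold lap
  have := (HasDerivAt.fun_sum (u := Finset.univ) fun j _ => pd_line (pd_contDiff (pd_contDiff hf j) j) k x)
  exact (((lap_contDiff hf).differentiable (by simp) x).hasFDerivAt.hasLineDerivAt _).unique this

lemma hd_conj_mul {f g : ℝ → ℂ} {f' g' : ℂ} {s : ℝ} (hf : HasDerivAt f f' s)
    (hg : HasDerivAt g g' s) :
    HasDerivAt (fun t => starRingEnd ℂ (f t) * g t)
      (starRingEnd ℂ f' * g s + starRingEnd ℂ (f s) * g') s := by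
  have := hf.star
  exact this.mul hg

lemma hd_re {f g : ℝ → ℂ} {f' g' : ℂ} {s : ℝ} (hf : HasDerivAt f f' s)
    (hg : HasDerivAt g g' s) :
    HasDerivAt (fun t => (starRingEnd ℂ (f t) * g t).re)
      ((starRingEnd ℂ f' * g s).re + (starRingEnd ℂ (f s) * g').re) s := by
  have := Complex.reCLM.hasFDerivAt.comp_hasDerivAt s (hd_conj_mul hf hg)
  rw [← Complex.add_re]
  exact this

lemma hd_im {f g : ℝ → ℂ} {f' g' : ℂ} {s : ℝ} (hf : HasDerivAt f f' s)
    (hg : HasDerivAt g g' s) :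
    HasDerivAt (fun t => (starRingEnd ℂ (f t) * g t).im)
      ((starRingEnd ℂ f' * g s).im + (starRingEnd ℂ (f s) * g').im) s := by
  have := Complex.imCLM.hasFDerivAt.comp_hasDerivAt s (hd_conj_mul hf hg)
  rw [← Complex.add_im]
  exact this

lemma hd_rpow {f : ℝ → ℂ} {f' : ℂ} {s p : ℝ} (hp : 1 < p) (hf : HasDerivAt f f' s) :
    HasDerivAt (fun t => ‖f t‖ ^ (p + 1))
      ((p + 1) * ‖f s‖ ^ (p - 1) * (starRingEnd ℂ (f s) * f').re) s := by
  have := (hasFDerivAt_norm_rpow (f s) (p := p + 1) (by linarith)).comp_hasDerivAt s hf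
  refine HasDerivAt.congr_deriv this ?_
  change ((p + 1) * ‖f s‖ ^ (p + 1 - 2)) * inner ℝ (f s) f' = _
  rw [Complex.inner, mul_comm f', show p + 1 - 2 = p - 1 by ring]

lemma line_re {f g : En n → ℂ} {f' g' : ℂ} {x v : En n} (hf : HasLineDerivAt ℝ f f' x v)
    (hg : HasLineDerivAt ℝ g g' x v) :
    HasLineDerivAt ℝ (fun y => (starRingEnd ℂ (f y) * g y).re)
      ((starRingEnd ℂ f' * g x).re + (starRingEnd ℂ (f x) * g').re) x v := by
  have := hd_re hf hg
  simpa [HasLineDerivAt] using this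

lemma line_im {f g : En n → ℂ} {f' g' : ℂ} {x v : En n} (hf : HasLineDerivAt ℝ f f' x v)
    (hg : HasLineDerivAt ℝ g g' x v) :
    HasLineDerivAt ℝ (fun y => (starRingEnd ℂ (f y) * g y).im)
      ((starRingEnd ℂ f' * g x).im + (starRingEnd ℂ (f x) * g').im) x v := by
  have := hd_im hf hg
  simpa [HasLineDerivAt] using this

lemma line_rpow {f : En n → ℂ} {f' : ℂ} {x v : En n} {p : ℝ} (hp : 1 < p)
    (hf : HasLineDerivAt ℝ f f' x v) :
    HasLineDerivAt ℝ (fun y => ‖f y‖ ^ (p + 1))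
      ((p + 1) * ‖f x‖ ^ (p - 1) * (starRingEnd ℂ (f x) * f').re) x v := by
  have := hd_rpow hp hf
  simpa [HasLineDerivAt] using this

lemma line_mul {f g : En n → ℝ} {f' g' : ℝ} {x v : En n} (hf : HasLineDerivAt ℝ f f' x v)
    (hg : HasLineDerivAt ℝ g g' x v) :
    HasLineDerivAt ℝ (fun y => f y * g y) (f' * g x + f x * g') x v := by
  have := HasDerivAt.fun_mul hf hg
  simpa [HasLineDerivAt] using this

lemma integral_line_zero {F F' : En n → ℝ} {v : En n} (hF : Integrable F) (hF' : Integrable F')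
    (h : ∀ x, HasLineDerivAt ℝ F (F' x) x v) : ∫ x, F' x = 0 := by
  have := integral_bilinear_hasLineDerivAt_right_eq_neg_left_of_integrable
    (μ := (volume : Measure (En n))) (f := fun _ => (1 : ℝ)) (f' := fun _ => (0 : ℝ)) (g := F)
    (g' := F') (v := v) (B := ContinuousLinearMap.mul ℝ ℝ) (by simp) (by simpa using hF')
    (by simpa using hF) (fun x _ => hasDerivAt_const _ _) (fun x _ => h x)
  simpa using this

lemma rlap_normSq {f : En n → ℂ} (hf : ContDiff ℝ (⊤ : ℕ∞) f) (x : En n) :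
    rlap (fun z => ‖f z‖ ^ 2) x = 2 * (starRingEnd ℂ (f x) * lap f x).re
      + 2 * ∑ j, (starRingEnd ℂ (pd j f x) * pd j f x).re := by
  have e0 : (fun z => ‖f z‖ ^ 2) = fun z => (starRingEnd ℂ (f z) * f z).re := by
    funext z
    rw [← Complex.normSq_eq_conj_mul_self, Complex.ofReal_re, Complex.normSq_eq_norm_sq]
  have hc : ContDiff ℝ (⊤ : ℕ∞) (fun z => ‖f z‖ ^ 2) := hf.norm_sq ℝ
  have e1 : ∀ j, rpd j (fun z => ‖f z‖ ^ 2) = fun z => 2 * (starRingEnd ℂ (f z) * pd j f z).re := by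
    intro j; funext z
    have h1 := rpd_line hc j z
    have h2 := line_re (pd_line hf j z) (pd_line hf j z)
    rw [← e0] at h2
    rw [h1.unique h2]
    simp; ring
  have e2 : ∀ j, rpd j (rpd j (fun z => ‖f z‖ ^ 2)) x =
      2 * ((starRingEnd ℂ (pd j f x) * pd j f x).re + (starRingEnd ℂ (f x) * pd j (pd j f) x).re) := by
    intro j
    have h1 := rpd_line (rpd_contDiff hc j) j x
    have h2 := HasDerivAt.const_mul 2 (line_re (pd_line hf j x) (pd_line (pd_contDiff hf j) j x))
    rw [e1] at h1
    rw [e1]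
    exact h1.unique h2
  unfold rlap lap
  simp only [e2]
  rw [Finset.mul_sum, Complex.re_sum, Finset.mul_sum, Finset.mul_sum, ← Finset.sum_add_distrib]
  exact Finset.sum_congr rfl fun j _ => by ring

end derivs

/-! ### The local conservation law -/

section conservation
variable {n : ℕ}

/-- time derivative of the momentum density -/
def momD (p lam : ℝ) (k : Fin n) (f : En n → ℂ) (x : En n) : ℝ :=
  (starRingEnd ℂ (f x) * pd k (lap f) x).re - (starRingEnd ℂ (pd k f x) * lap f x).re
    - (p - 1) * lam * (‖f x‖ ^ (p - 1) * (starRingEnd ℂ (f x) * pd k f x).re)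

/-- scalar part of the stress tensor -/
def strQ (p lam : ℝ) (f : En n → ℂ) (x : En n) : ℝ :=
  (starRingEnd ℂ (f x) * lap f x).re + ∑ j, (starRingEnd ℂ (pd j f x) * pd j f x).re
    - lam * ((p - 1) / (p + 1)) * ‖f x‖ ^ (p + 1)

/-- derivative of `strQ` -/
def strQD (p lam : ℝ) (k : Fin n) (f : En n → ℂ) (x : En n) : ℝ :=
  (starRingEnd ℂ (pd k f x) * lap f x).re + (starRingEnd ℂ (f x) * pd k (lap f) x).re
    + ∑ j, ((starRingEnd ℂ (pd k (pd j f) x) * pd j f x).re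
        + (starRingEnd ℂ (pd j f x) * pd k (pd j f) x).re)
    - lam * ((p - 1) / (p + 1)) *
      ((p + 1) * ‖f x‖ ^ (p - 1) * (starRingEnd ℂ (f x) * pd k f x).re)

/-- the flux field -/
def fluxV (p lam : ℝ) (a : En n → ℝ) (j : Fin n) (f : En n → ℂ) (x : En n) : ℝ :=
  ∑ k, rpd k a x * (-2 * (starRingEnd ℂ (pd j f x) * pd k f x).re) + rpd j a x * strQ p lam f x

/-- derivative of the flux field -/
def fluxVD (p lam : ℝ) (a : En n → ℝ) (j : Fin n) (f : En n → ℂ) (x : En n) : ℝ :=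
  ∑ k, (rpd j (rpd k a) x * (-2 * (starRingEnd ℂ (pd j f x) * pd k f x).re)
      + rpd k a x * (-2 * ((starRingEnd ℂ (pd j (pd j f) x) * pd k f x).re
        + (starRingEnd ℂ (pd j f x) * pd j (pd k f) x).re)))
    + (rpd j (rpd j a) x * strQ p lam f x + rpd j a x * strQD p lam j f x)

lemma line_const_mul {f : En n → ℝ} {f' : ℝ} {x v : En n} (c : ℝ) (hf : HasLineDerivAt ℝ f f' x v) :
    HasLineDerivAt ℝ (fun y => c * f y) (c * f') x v :=
  HasDerivAt.const_mul c hf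

lemma strQ_line {p lam : ℝ} (hp : 1 < p) {f : En n → ℂ} (hf : ContDiff ℝ (⊤ : ℕ∞) f)
    (k : Fin n) (x : En n) :
    HasLineDerivAt ℝ (strQ p lam f) (strQD p lam k f x) x (EuclideanSpace.single k 1) := by
  have hl := ((lap_contDiff hf).differentiable (by simp) x).hasFDerivAt.hasLineDerivAt
    (EuclideanSpace.single k (1 : ℝ))
  have h1 := line_re (pd_line hf k x) hl
  have h2 := HasDerivAt.fun_sum (u := Finset.univ) fun j _ =>
    line_re (pd_line (pd_contDiff hf j) k x) (pd_line (pd_contDiff hf j) k x)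
  have h3 := HasDerivAt.const_mul (lam * ((p - 1) / (p + 1))) (line_rpow hp (pd_line hf k x))
  exact HasDerivAt.fun_sub (HasDerivAt.fun_add h1 h2) h3

lemma fluxV_line {p lam : ℝ} (hp : 1 < p) {f : En n → ℂ} (hf : ContDiff ℝ (⊤ : ℕ∞) f)
    {a : En n → ℝ} (ha : ContDiff ℝ (⊤ : ℕ∞) a) (j : Fin n) (x : En n) :
    HasLineDerivAt ℝ (fluxV p lam a j f) (fluxVD p lam a j f x) x (EuclideanSpace.single j 1) := by
  have h1 := HasDerivAt.fun_sum (u := Finset.univ) fun k _ =>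
    line_mul (rpd_line (rpd_contDiff ha k) j x) (line_const_mul (-2)
      (line_re (pd_line (pd_contDiff hf j) j x) (pd_line (pd_contDiff hf k) j x)))
  have h2 := line_mul (rpd_line (rpd_contDiff ha j) j x) (strQ_line (lam := lam) hp hf j x)
  exact HasDerivAt.fun_add h1 h2

lemma re_symm (z w : ℂ) : (starRingEnd ℂ z * w).re = (starRingEnd ℂ w * z).re := by
  simp; ring

lemma momD_eq {p lam : ℝ} (hp : 1 < p) {f : En n → ℂ} (hf : ContDiff ℝ (⊤ : ℕ∞) f)
    (k : Fin n) (x : En n) :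
    momD p lam k f x = ∑ j, (-2 * ((starRingEnd ℂ (pd j (pd j f) x) * pd k f x).re
        + (starRingEnd ℂ (pd j f x) * pd j (pd k f) x).re)) + strQD p lam k f x := by
  have e1 : ∑ j, (starRingEnd ℂ (pd j (pd j f) x) * pd k f x).re
      = (starRingEnd ℂ (pd k f x) * lap f x).re := by
    rw [re_symm (pd k f x), lap, map_sum, Finset.sum_mul, Complex.re_sum]
  have e2 : ∀ j, (starRingEnd ℂ (pd k (pd j f) x) * pd j f x).re
      = (starRingEnd ℂ (pd j f x) * pd j (pd k f) x).re := by
    intro j; rw [re_symm, pd_symm hf]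
  have e3 : ∀ j, (starRingEnd ℂ (pd j f x) * pd k (pd j f) x).re
      = (starRingEnd ℂ (pd j f x) * pd j (pd k f) x).re := by
    intro j; rw [pd_symm hf]
  unfold momD strQD
  simp only [e2, e3]
  rw [← Finset.mul_sum, Finset.sum_add_distrib, Finset.sum_add_distrib, e1]
  have : p + 1 ≠ 0 := by linarith
  field_simp
  ring

lemma local_law {p lam : ℝ} (hp : 1 < p) {f : En n → ℂ} (hf : ContDiff ℝ (⊤ : ℕ∞) f)
    {a : En n → ℝ} (x : En n) :
    ∑ k, rpd k a x * momD p lam k f x =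
      (rlap a x * (-(1 / 2) * rlap (fun z => ‖f z‖ ^ 2) x
              + lam * ((p - 1) / (p + 1)) * ‖f x‖ ^ (p + 1))
      + 2 * ∑ j, ∑ k, rpd j (rpd k a) x * (starRingEnd ℂ (pd j f x) * pd k f x).re)
      + ∑ j, fluxVD p lam a j f x := by
  have e : rlap a x * (-(1 / 2) * rlap (fun z => ‖f z‖ ^ 2) x
              + lam * ((p - 1) / (p + 1)) * ‖f x‖ ^ (p + 1))
      = - (∑ j, rpd j (rpd j a) x * strQ p lam f x) := by
    rw [rlap_normSq hf, ← Finset.sum_mul, strQ, rlap]; ring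
  rw [e]
  simp only [momD_eq hp hf, fluxVD, Finset.sum_add_distrib, mul_add, Finset.mul_sum]
  rw [Finset.sum_comm (f := fun j k => rpd k a x * (-2 * (starRingEnd ℂ (pd j (pd j f) x) * pd k f x).re)),
    Finset.sum_comm (f := fun j k => rpd k a x * (-2 * (starRingEnd ℂ (pd j f x) * pd j (pd k f) x).re))]
  have e4 : ∑ j, ∑ k, rpd j (rpd k a) x * (-2 * (starRingEnd ℂ (pd j f x) * pd k f x).re)
      = - ∑ j, ∑ k, 2 * (rpd j (rpd k a) x * (starRingEnd ℂ (pd j f x) * pd k f x).re) := by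
    simp only [← Finset.sum_neg_distrib]
    refine Finset.sum_congr rfl fun j _ => Finset.sum_congr rfl fun k _ => by ring
  rw [e4]
  ring

section decay2
variable {S : Set ℝ} {u : ℝ → En n → ℂ}

lemma AllDec.lapDec (h : AllDec S u) : RapDec S (fun t => lap (u t)) :=
  RapDec.sum Finset.univ fun j => ((h.pd j).pd j).rapDec

lemma AllDec.pdlapDec (h : AllDec S u) (k : Fin n) : RapDec S (fun t => _root_.pd k (lap (u t))) := by
  have := RapDec.sum Finset.univ fun j => (((h.pd j).pd j).pd k).rapDec
  intro N
  obtain ⟨C, hC⟩ := this N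
  refine ⟨C, fun t ht x => ?_⟩
  beta_reduce
  rw [pd_lap (h.1 t)]
  exact hC t ht x

lemma AllDec.momD (h : AllDec S u) {p : ℝ} (lam : ℝ) (hp : 1 < p) (k : Fin n) :
    RapDec S (fun t => momD p lam k (u t)) := by
  refine RapDec.sub (RapDec.sub (h.rapDec.re (h.pdlapDec k)) ((h.pd k).rapDec.re h.lapDec)) ?_
  exact RapDec.const_mul ((h.rapDec.re (h.pd k).rapDec).mulL
    (h.rapDec.rpow_polGr (q := p - 1) (by linarith))) _

lemma AllDec.strQ (h : AllDec S u) {p : ℝ} (lam : ℝ) (hp : 1 < p) :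
    RapDec S (fun t => strQ p lam (u t)) := by
  refine RapDec.sub (RapDec.add (h.rapDec.re h.lapDec) (RapDec.sum _ fun j =>
    (h.pd j).rapDec.re (h.pd j).rapDec)) ?_
  exact RapDec.const_mul (h.rapDec.rpow (by linarith)) _

lemma AllDec.strQD (h : AllDec S u) {p : ℝ} (lam : ℝ) (hp : 1 < p) (k : Fin n) :
    RapDec S (fun t => strQD p lam k (u t)) := by
  refine RapDec.sub (RapDec.add (RapDec.add ((h.pd k).rapDec.re h.lapDec)
    (h.rapDec.re (h.pdlapDec k))) (RapDec.sum _ fun j =>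
    RapDec.add (((h.pd j).pd k).rapDec.re (h.pd j).rapDec)
      ((h.pd j).rapDec.re ((h.pd j).pd k).rapDec))) ?_
  have := RapDec.const_mul (RapDec.const_mul ((h.rapDec.re (h.pd k).rapDec).mulL
    (h.rapDec.rpow_polGr (q := p - 1) (by linarith))) (p + 1)) (lam * ((p - 1) / (p + 1)))
  simpa only [mul_assoc] using this

lemma AllDec.fluxV (h : AllDec S u) {p : ℝ} (lam : ℝ) (hp : 1 < p) {a : En n → ℝ}
    (h1 : ∀ k, PolGr S (fun _ => rpd k a)) (j : Fin n) :
    RapDec S (fun t => fluxV p lam a j (u t)) := by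
  refine RapDec.add (RapDec.sum _ fun k => ?_) ((h.strQ lam hp).mulL (h1 j))
  exact (((h.pd j).rapDec.re (h.pd k).rapDec).const_mul _).mulL (h1 k)

lemma AllDec.fluxVD (h : AllDec S u) {p : ℝ} (lam : ℝ) (hp : 1 < p) {a : En n → ℝ}
    (h1 : ∀ k, PolGr S (fun _ => rpd k a)) (h2 : ∀ j k, PolGr S (fun _ => rpd j (rpd k a)))
    (j : Fin n) :
    RapDec S (fun t => fluxVD p lam a j (u t)) := by
  refine RapDec.add (RapDec.sum _ fun k => RapDec.add ?_ ?_)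
    (RapDec.add ((h.strQ lam hp).mulL (h2 j j)) ((h.strQD lam hp j).mulL (h1 j)))
  · exact (((h.pd j).rapDec.re (h.pd k).rapDec).const_mul _).mulL (h2 j k)
  · exact ((((h.pd j).pd j).rapDec.re (h.pd k).rapDec).add
      ((h.pd j).rapDec.re ((h.pd k).pd j).rapDec)).const_mul _ |>.mulL (h1 k)

end decay2

section cont
variable {f : En n → ℂ} (hf : ContDiff ℝ (⊤ : ℕ∞) f)

lemma cont_re {f g : En n → ℂ} (hf : Continuous f) (hg : Continuous g) :
    Continuous (fun x => (starRingEnd ℂ (f x) * g x).re) :=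
  Complex.continuous_re.comp ((Complex.continuous_conj.comp hf).mul hg)

lemma cont_im {f g : En n → ℂ} (hf : Continuous f) (hg : Continuous g) :
    Continuous (fun x => (starRingEnd ℂ (f x) * g x).im) :=
  Complex.continuous_im.comp ((Complex.continuous_conj.comp hf).mul hg)

lemma cont_rpow {f : En n → ℂ} (hf : Continuous f) {q : ℝ} (hq : 0 ≤ q) :
    Continuous (fun x => ‖f x‖ ^ q) :=
  hf.norm.rpow_const fun _ => Or.inr hq

lemma momD_cont {f : En n → ℂ} (hf : ContDiff ℝ (⊤ : ℕ∞) f) {p lam : ℝ} (hp : 1 < p) (k : Fin n) :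
    Continuous (momD p lam k f) := by
  have c0 := hf.continuous
  have c1 := (pd_contDiff hf k).continuous
  have c2 := (lap_contDiff hf).continuous
  have c3 := (pd_contDiff (lap_contDiff hf) k).continuous
  exact ((cont_re c0 c3).sub (cont_re c1 c2)).sub (continuous_const.mul
    ((cont_rpow c0 (by linarith)).mul (cont_re c0 c1)))

lemma strQ_cont {f : En n → ℂ} (hf : ContDiff ℝ (⊤ : ℕ∞) f) {p lam : ℝ} (hp : 1 < p) :
    Continuous (strQ p lam f) := by
  have c0 := hf.continuous
  have c1 := fun k => (pd_contDiff hf k).continuous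
  have c2 := (lap_contDiff hf).continuous
  exact ((cont_re c0 c2).add (continuous_finsetSum _ fun j _ => cont_re (c1 j) (c1 j))).sub
    (continuous_const.mul (cont_rpow c0 (by linarith)))

lemma strQD_cont {f : En n → ℂ} (hf : ContDiff ℝ (⊤ : ℕ∞) f) {p lam : ℝ} (hp : 1 < p)
    (k : Fin n) : Continuous (strQD p lam k f) := by
  have c0 := hf.continuous
  have c1 := fun k => (pd_contDiff hf k).continuous
  have c2 := (lap_contDiff hf).continuous
  have c3 := (pd_contDiff (lap_contDiff hf) k).continuous
  have c4 := fun j => (pd_contDiff (pd_contDiff hf j) k).continuous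
  exact (((cont_re (c1 k) c2).add (cont_re c0 c3)).add (continuous_finsetSum _ fun j _ =>
    (cont_re (c4 j) (c1 j)).add (cont_re (c1 j) (c4 j)))).sub
    (continuous_const.mul ((continuous_const.mul (cont_rpow c0 (by linarith))).mul
      (cont_re c0 (c1 k))))

lemma fluxV_cont {f : En n → ℂ} (hf : ContDiff ℝ (⊤ : ℕ∞) f) {p lam : ℝ} (hp : 1 < p)
    {a : En n → ℝ} (ha : ContDiff ℝ (⊤ : ℕ∞) a) (j : Fin n) : Continuous (fluxV p lam a j f) := by
  have c1 := fun k => (pd_contDiff hf k).continuous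
  have a1 := fun k => (rpd_contDiff ha k).continuous
  exact (continuous_finsetSum _ fun k _ => (a1 k).mul (continuous_const.mul
    (cont_re (c1 j) (c1 k)))).add ((a1 j).mul (strQ_cont hf hp))

lemma fluxVD_cont {f : En n → ℂ} (hf : ContDiff ℝ (⊤ : ℕ∞) f) {p lam : ℝ} (hp : 1 < p)
    {a : En n → ℝ} (ha : ContDiff ℝ (⊤ : ℕ∞) a) (j : Fin n) : Continuous (fluxVD p lam a j f) := by
  have c1 := fun k => (pd_contDiff hf k).continuous
  have c2 := fun k => (pd_contDiff (pd_contDiff hf k) j).continuous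
  have a1 := fun k => (rpd_contDiff ha k).continuous
  have a2 := fun k => (rpd_contDiff (rpd_contDiff ha k) j).continuous
  exact (continuous_finsetSum _ fun k _ => ((a2 k).mul (continuous_const.mul
    (cont_re (c1 j) (c1 k)))).add ((a1 k).mul (continuous_const.mul
      ((cont_re (c2 j) (c1 k)).add (cont_re (c1 j) (c2 k)))))).add
    (((a2 j).mul (strQ_cont hf hp)).add ((a1 j).mul (strQD_cont hf hp j)))

end cont

/-! ### Time derivative of the momentum density -/

lemma mom_hasDerivAt {p lam : ℝ} (hp : 1 < p) {u : ℝ → En n → ℂ} (hu : NLSSolution n p lam u)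
    (k : Fin n) (t : ℝ) (x : En n) :
    HasDerivAt (fun s => mom u k s x) (momD p lam k (u t) x) t := by
  set U : ℝ × En n → ℂ := fun q => u q.1 q.2 with hU
  have hUs : ContDiff ℝ (⊤ : ℕ∞) U := hu.smooth
  have hus : ∀ s, ContDiff ℝ (⊤ : ℕ∞) (u s) := fun s =>
    hUs.comp (contDiff_const.prodMk contDiff_id)
  set e : En n := EuclideanSpace.single k 1 with he
  set A : ℝ × En n → ℂ := fun q => fderiv ℝ U q (0, e) with hA
  set B : ℝ × En n → ℂ := fun q => fderiv ℝ U q (1, 0) with hB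
  have hAs : ContDiff ℝ (⊤ : ℕ∞) A := contDiff_dir hUs _
  have hBs : ContDiff ℝ (⊤ : ℕ∞) B := contDiff_dir hUs _
  have tder : ∀ {W : ℝ × En n → ℂ}, ContDiff ℝ (⊤ : ℕ∞) W → ∀ s y,
      HasDerivAt (fun r => W (r, y)) (fderiv ℝ W (s, y) (1, 0)) s := by
    intro W hW s y
    have h1 : HasDerivAt (fun r : ℝ => (r, y)) ((1 : ℝ), (0 : En n)) s :=
      (hasDerivAt_id s).prodMk (hasDerivAt_const s y)
    exact ((hW.differentiable (by simp)) (s, y)).hasFDerivAt.comp_hasDerivAt s h1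
  have xder : ∀ {W : ℝ × En n → ℂ}, ContDiff ℝ (⊤ : ℕ∞) W → ∀ s y,
      HasLineDerivAt ℝ (fun z => W (s, z)) (fderiv ℝ W (s, y) (0, e)) y e := by
    intro W hW s y
    have h1 := ((hW.differentiable (by simp)) (s, y)).hasFDerivAt.hasLineDerivAt ((0 : ℝ), e)
    simpa [HasLineDerivAt] using h1
  have hpd : ∀ s y, pd k (u s) y = A (s, y) := fun s y =>
    (pd_line (hus s) k y).unique (xder hUs s y)
  have hBd : ∀ y, deriv (fun s => u s y) t = B (t, y) := fun y => (tder hUs t y).deriv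
  have hBeq : ∀ y, B (t, y) = Complex.I * lap (u t) y
      - Complex.I * ((lam : ℂ) * ((‖u t y‖ ^ (p - 1) : ℝ) : ℂ) * u t y) := by
    intro y
    have h := hu.eq t y
    rw [hBd] at h
    rw [← h]
    linear_combination (B (t, y)) * Complex.I_mul_I
  -- time derivative
  have h1 : HasDerivAt (fun s => mom u k s x)
      ((starRingEnd ℂ (B (t, x)) * A (t, x)).im
        + (starRingEnd ℂ (u t x) * fderiv ℝ A (t, x) (1, 0)).im) t := by
    have := hd_im (tder hUs t x) (tder hAs t x)
    have e1 : (fun s => mom u k s x) = fun s => (starRingEnd ℂ (U (s, x)) * A (s, x)).im := by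
      funext s; unfold mom; rw [hpd]
    rw [e1]; exact this
  rw [show fderiv ℝ A (t, x) (1, 0) = fderiv ℝ B (t, x) (0, e) from dir_symm hUs _ _ _] at h1
  -- spatial derivative of the mass flux relation
  have h2 := line_im (xder hUs t x) (xder hBs t x)
  have hpt : ∀ (z w : ℂ) (r : ℝ) (y : ℂ),
      (starRingEnd ℂ z * (Complex.I * w - Complex.I * ((lam : ℂ) * (r : ℂ) * y))).im
        = (starRingEnd ℂ z * w).re - lam * r * (starRingEnd ℂ z * y).re := by
    intro z w r y
    simp; ring
  have e2 : (fun z => (starRingEnd ℂ (U (t, z)) * B (t, z)).im)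
      = fun z => (starRingEnd ℂ (u t z) * lap (u t) z).re - lam * ‖u t z‖ ^ (p + 1) := by
    funext z
    rw [hBeq, hpt]
    have : (starRingEnd ℂ (u t z) * u t z).re = ‖u t z‖ ^ (2 : ℝ) := by
      rw [← Complex.normSq_eq_conj_mul_self, Complex.ofReal_re, Complex.normSq_eq_norm_sq]
      norm_cast
    change (starRingEnd ℂ (u t z) * lap (u t) z).re
      - lam * ‖u t z‖ ^ (p - 1) * (starRingEnd ℂ (u t z) * u t z).re = _
    rw [this, mul_assoc, ← Real.rpow_add_of_nonneg (norm_nonneg _) (by linarith) (by norm_num)]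
    ring_nf
  rw [e2] at h2
  have hl := ((lap_contDiff (hus t)).differentiable (by simp) x).hasFDerivAt.hasLineDerivAt e
  have h3 := HasDerivAt.fun_sub (line_re (pd_line (hus t) k x) hl)
    (HasDerivAt.const_mul lam (line_rpow hp (pd_line (hus t) k x)))
  have h4 := h2.unique h3
  refine h1.congr_deriv ?_
  have e5 : (starRingEnd ℂ (B (t, x)) * A (t, x)).im = - (starRingEnd ℂ (A (t, x)) * B (t, x)).im := by
    simp; ring
  have e6 : (starRingEnd ℂ (A (t, x)) * B (t, x)).im =
      (starRingEnd ℂ (pd k (u t) x) * lap (u t) x).re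
        - lam * ‖u t x‖ ^ (p - 1) * (starRingEnd ℂ (u t x) * pd k (u t) x).re := by
    rw [hBeq, hpt, ← hpd, re_symm (pd k (u t) x) (u t x)]
  change (starRingEnd ℂ (A (t, x)) * B (t, x)).im + (starRingEnd ℂ (u t x) * fderiv ℝ B (t, x) (0, e)).im
    = (starRingEnd ℂ (pd k (u t) x) * lap (u t) x).re +
      (starRingEnd ℂ (u t x) * pd k (lap (u t)) x).re - lam * ((p + 1) * ‖u t x‖ ^ (p - 1) *
        (starRingEnd ℂ (u t x) * pd k (u t) x).re) at h4
  unfold momD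
  rw [e5]
  linear_combination h4 - 2 * e6

end conservation

/-- One-particle Morawetz identity for NLS. -/
theorem statement_3 (n : ℕ) (hn : 1 ≤ n) (p lam : ℝ) (hp : 1 < p)
    (u : ℝ → En n → ℂ) (hu : NLSSolution n p lam u)
    (a : En n → ℝ) (ha : ContDiff ℝ (⊤ : ℕ∞) a)
    (hpoly : ∀ k : ℕ, ∃ C : ℝ, ∃ m : ℕ, ∀ x : En n,
        ‖iteratedFDeriv ℝ k a x‖ ≤ C * (1 + ‖x‖) ^ m)
    (t : ℝ) :
    deriv (fun s => ∫ x : En n, ∑ j, rpd j a x * mom u j s x) t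
      = (∫ x : En n, rlap a x *
            (-(1 / 2) * rlap (fun z => ‖u t z‖ ^ 2) x
              + lam * ((p - 1) / (p + 1)) * ‖u t x‖ ^ (p + 1)))
        + 2 * ∫ x : En n, ∑ j, ∑ k,
            rpd j (rpd k a) x * (starRingEnd ℂ (pd j (u t) x) * pd k (u t) x).re := by
  have hus : ∀ s, ContDiff ℝ (⊤ : ℕ∞) (u s) := fun s =>
    hu.smooth.comp (contDiff_const.prodMk contDiff_id)
  set S : Set ℝ := Metric.ball t 1 with hS
  have htS : t ∈ S := Metric.mem_ball_self one_pos
  have hD : AllDec S u := by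
    refine ⟨hus, fun k N => ?_⟩
    obtain ⟨C, hC⟩ := hu.decay k N (|t| + 1)
    obtain ⟨C0, hC0⟩ := hu.decay k 0 (|t| + 1)
    refine ⟨2 ^ (N - 1) * (C0 + C), fun s hs x => ?_⟩
    have hs' : |s| ≤ |t| + 1 := by
      rw [hS, Metric.mem_ball, Real.dist_eq] at hs
      have := abs_add_le (s - t) t
      simp only [sub_add_cancel] at this
      linarith
    have b1 := hC s hs' x
    have b0 := hC0 s hs' x
    have b2 := add_pow_le (zero_le_one (α := ℝ)) (norm_nonneg x) N
    rw [norm_norm]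
    calc (1 + ‖x‖) ^ N * ‖iteratedFDeriv ℝ k (u s) x‖
        ≤ (2 ^ (N - 1) * (1 ^ N + ‖x‖ ^ N)) * ‖iteratedFDeriv ℝ k (u s) x‖ := by gcongr
      _ = 2 ^ (N - 1) * (‖x‖ ^ 0 * ‖iteratedFDeriv ℝ k (u s) x‖
          + ‖x‖ ^ N * ‖iteratedFDeriv ℝ k (u s) x‖) := by simp only [one_pow, pow_zero]; ring
      _ ≤ 2 ^ (N - 1) * (C0 + C) := by gcongr
  have g1 : ∀ k, PolGr S (fun _ => rpd k a) := by
    intro k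
    obtain ⟨C, m, hC⟩ := hpoly 1
    refine ⟨C, m, fun s _ x => le_trans ?_ (hC x)⟩
    have := norm_iter_dir ha k 0 x
    rwa [norm_iteratedFDeriv_zero] at this
  have g2 : ∀ j k, PolGr S (fun _ => rpd j (rpd k a)) := by
    intro j k
    obtain ⟨C, m, hC⟩ := hpoly 2
    refine ⟨C, m, fun s _ x => le_trans ?_ (hC x)⟩
    have h1 := norm_iter_dir (rpd_contDiff ha k) j 0 x
    have h2 := norm_iter_dir ha k 1 x
    rw [norm_iteratedFDeriv_zero] at h1
    exact h1.trans h2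
  have a1 := fun k => (rpd_contDiff ha k).continuous
  have a2 := fun j k => (rpd_contDiff (rpd_contDiff ha k) j).continuous
  have c1 := fun s k => (pd_contDiff (hus s) k).continuous
  -- differentiate under the integral sign
  have hFdec : RapDec S (fun s x => ∑ j, rpd j a x * mom u j s x) :=
    RapDec.sum _ fun j => (hD.rapDec.im (hD.pd j).rapDec).mulL (g1 j)
  have hFcont : ∀ s, Continuous (fun x => ∑ j, rpd j a x * mom u j s x) := fun s =>
    continuous_finsetSum _ fun j _ => (a1 j).mul (cont_im (hus s).continuous (c1 s j))
  have hGdec : RapDec S (fun s x => ∑ j, rpd j a x * momD p lam j (u s) x) :=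
    RapDec.sum _ fun j => (hD.momD lam hp j).mulL (g1 j)
  have hGcont : Continuous (fun x => ∑ j, rpd j a x * momD p lam j (u t) x) :=
    continuous_finsetSum _ fun j _ => (a1 j).mul (momD_cont (hus t) hp j)
  obtain ⟨C, hC⟩ := hGdec.bound
  have key := (hasDerivAt_integral_of_dominated_loc_of_deriv_le (μ := (volume : Measure (En n)))
    (F := fun s x => ∑ j, rpd j a x * mom u j s x)
    (F' := fun s x => ∑ j, rpd j a x * momD p lam j (u s) x)
    (bound := fun x => C * ((1 + ‖x‖) ^ (n + 1))⁻¹)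
    (s := S) (x₀ := t) (Metric.ball_mem_nhds t one_pos)
    (Filter.Eventually.of_forall fun s => (hFcont s).aestronglyMeasurable)
    (hFdec.integrable htS (hFcont t)) hGcont.aestronglyMeasurable
    (Filter.Eventually.of_forall fun x s hs => hC s hs x)
    ((integrable_bound n).const_mul C)
    (Filter.Eventually.of_forall fun x s _ =>
      HasDerivAt.fun_sum fun j _ => (mom_hasDerivAt hp hu j s x).const_mul _)).2
  rw [key.deriv]
  simp only [local_law hp (hus t)]
  -- integrability of the pieces
  have i1 : Integrable (fun x => rlap a x * (-(1 / 2) * rlap (fun z => ‖u t z‖ ^ 2) x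
      + lam * ((p - 1) / (p + 1)) * ‖u t x‖ ^ (p + 1))) := by
    have e : (fun x => rlap a x * (-(1 / 2) * rlap (fun z => ‖u t z‖ ^ 2) x
      + lam * ((p - 1) / (p + 1)) * ‖u t x‖ ^ (p + 1)))
      = fun x => ∑ j, -1 * (rpd j (rpd j a) x * strQ p lam (u t) x) := by
      funext x
      rw [rlap_normSq (hus t), ← Finset.mul_sum, ← Finset.sum_mul, strQ, rlap]; ring
    rw [e]
    exact (RapDec.sum Finset.univ fun j => ((hD.strQ lam hp).mulL (g2 j j)).const_mul (-1)).integrable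
      htS (continuous_finsetSum _ fun j _ => continuous_const.mul ((a2 j j).mul (strQ_cont (hus t) hp)))
  have i2 : Integrable (fun x => ∑ j, ∑ k,
      rpd j (rpd k a) x * (starRingEnd ℂ (pd j (u t) x) * pd k (u t) x).re) :=
    (RapDec.sum Finset.univ fun j => RapDec.sum Finset.univ fun k =>
      ((hD.pd j).rapDec.re (hD.pd k).rapDec).mulL (g2 j k)).integrable htS
      (continuous_finsetSum _ fun j _ => continuous_finsetSum _ fun k _ =>
        (a2 j k).mul (cont_re (c1 t j) (c1 t k)))
  have i3 : ∀ j, Integrable (fluxVD p lam a j (u t)) := fun j =>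
    (hD.fluxVD lam hp g1 g2 j).integrable htS (fluxVD_cont (hus t) hp ha j)
  have z : ∀ j, ∫ x, fluxVD p lam a j (u t) x = 0 := fun j =>
    integral_line_zero ((hD.fluxV lam hp g1 j).integrable htS (fluxV_cont (hus t) hp ha j)) (i3 j)
      (fluxV_line hp (hus t) ha j)
  rw [integral_add (i1.fun_add (i2.const_mul 2)) (integrable_finsetSum _ fun j _ => i3 j),
    integral_add i1 (i2.const_mul 2), integral_finsetSum _ fun j _ => i3 j, integral_const_mul]
  simp [z]
end
end

section
/- (One-dimensional two-particle Morawetz identity.) For n = 1, define the two-particle Morawetz action M(t) = ∫_ℝ ∫_ℝ |u(t,y)|² sgn(x−y) p(t,x) dx dy, where p = Im(ū ∂_x u) and sgn is the sign function (the x-derivative of |x−y|). Then for every t, d/dt M(t) = 2 ∫_ℝ ( ∂_x(|u(t,x)|²) )² dx + 2 λ ((p−1)/(p+1)) ∫_ℝ |u(t,x)|^{p+3} dx. -/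
open MeasureTheory Complex

noncomputable section

/-- `u : ℝ × ℝ → ℂ` is a smooth solution of the one-dimensional NLS
`i∂ₜu + ∂ₓ²u = λ|u|^{p-1}u`, Schwartz class in `x` locally uniformly in `t`. -/
structure NLSSolution1 (p lam : ℝ) (u : ℝ → ℝ → ℂ) : Prop where
  smooth : ContDiff ℝ (⊤ : ℕ∞) (fun q : ℝ × ℝ => u q.1 q.2)
  decay : ∀ (k N : ℕ) (T : ℝ), ∃ C : ℝ, ∀ t : ℝ, |t| ≤ T → ∀ x : ℝ,
      |x| ^ N * ‖iteratedDeriv k (u t) x‖ ≤ C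
  eq : ∀ (t x : ℝ),
      Complex.I * deriv (fun s => u s x) t + deriv (deriv (u t)) x
        = (lam : ℂ) * ((‖u t x‖ ^ (p - 1) : ℝ) : ℂ) * u t x

/-- Continuous real functions with quadratic decay. -/
def MDec (f : ℝ → ℝ) : Prop :=
  Continuous f ∧ ∃ C : ℝ, ∀ x, |f x| ≤ C * (1 + x ^ 2)⁻¹

lemma MDec.integrable {f : ℝ → ℝ} (h : MDec f) : Integrable f := by
  obtain ⟨hc, C, hC⟩ := h
  exact (integrable_inv_one_add_sq.const_mul C).mono' hc.aestronglyMeasurable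
    (Filter.Eventually.of_forall hC)

lemma MDec.tendsto_top {f : ℝ → ℝ} (h : MDec f) :
    Filter.Tendsto f Filter.atTop (nhds 0) := by
  obtain ⟨hc, C, hC⟩ := h
  refine squeeze_zero_norm hC ?_
  have : Filter.Tendsto (fun x : ℝ => 1 + x ^ 2) Filter.atTop Filter.atTop :=
    Filter.tendsto_atTop_add_const_left _ _ (Filter.tendsto_pow_atTop (by norm_num))
  simpa using this.inv_tendsto_atTop.const_mul C

lemma MDec.comp_neg {f : ℝ → ℝ} (h : MDec f) : MDec (fun x => f (-x)) := by
  obtain ⟨hc, C, hC⟩ := h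
  exact ⟨hc.comp continuous_neg, C, fun x => by simpa using hC (-x)⟩

lemma MDec.tendsto_bot {f : ℝ → ℝ} (h : MDec f) :
    Filter.Tendsto f Filter.atBot (nhds 0) := by
  have := h.comp_neg.tendsto_top.comp Filter.tendsto_neg_atBot_atTop
  simpa [Function.comp_def] using this

lemma morawetz_sgn_x {G G' : ℝ → ℝ} (hG : MDec G) (hG' : MDec G')
    (hd : ∀ x, HasDerivAt G (G' x) x) (y : ℝ) :
    ∫ x, Real.sign (x - y) * G' x = -2 * G y := by
  have hi := hG'.integrable
  have h1 : ∫ x in Set.Iic y, Real.sign (x - y) * G' x = - G y := by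
    have : ∫ x in Set.Iic y, Real.sign (x - y) * G' x = ∫ x in Set.Iic y, - G' x := by
      rw [integral_Iic_eq_integral_Iio, integral_Iic_eq_integral_Iio]
      refine setIntegral_congr_fun measurableSet_Iio fun x hx => ?_
      have : x - y < 0 := sub_neg.2 hx
      simp [Real.sign_of_neg this]
    rw [this, integral_neg, integral_Iic_of_hasDerivAt_of_tendsto' (fun x _ => hd x)
      hi.integrableOn hG.tendsto_bot]
    ring
  have h2 : ∫ x in Set.Ioi y, Real.sign (x - y) * G' x = - G y := by
    have : ∫ x in Set.Ioi y, Real.sign (x - y) * G' x = ∫ x in Set.Ioi y, G' x := by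
      refine setIntegral_congr_fun measurableSet_Ioi fun x hx => ?_
      have : 0 < x - y := sub_pos.2 hx
      simp [Real.sign_of_pos this]
    rw [this, integral_Ioi_of_hasDerivAt_of_tendsto' (fun x _ => hd x)
      hi.integrableOn hG.tendsto_top]
    ring
  have hI : Integrable (fun x => Real.sign (x - y) * G' x) := by
    refine hi.norm.mono' ?_ (Filter.Eventually.of_forall fun x => ?_)
    · refine Measurable.aestronglyMeasurable ?_
      refine Measurable.mul ?_ hG'.1.measurable
      unfold Real.sign
      refine Measurable.ite (measurableSet_lt (by fun_prop) (by fun_prop)) (by fun_prop) ?_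
      exact Measurable.ite (measurableSet_lt (by fun_prop) (by fun_prop)) (by fun_prop)
        (by fun_prop)
    · rw [norm_mul]
      have : ‖Real.sign (x - y)‖ ≤ 1 := by
        rcases Real.sign_apply_eq (x - y) with h | h | h <;> simp [h]
      exact mul_le_of_le_one_left (norm_nonneg _) this
  rw [← setIntegral_univ, ← Set.Iic_union_Ioi (a := y),
    setIntegral_union (Set.Iic_disjoint_Ioi le_rfl) measurableSet_Ioi hI.integrableOn
      hI.integrableOn, h1, h2]
  ring

lemma morawetz_sgn_y {G G' : ℝ → ℝ} (hG : MDec G) (hG' : MDec G')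
    (hd : ∀ x, HasDerivAt G (G' x) x) (x : ℝ) :
    ∫ y, G' y * Real.sign (x - y) = 2 * G x := by
  have := morawetz_sgn_x hG hG' hd x
  have h2 : (fun y => G' y * Real.sign (x - y)) = fun y => -(Real.sign (y - x) * G' y) := by
    funext y
    rw [← neg_sub y x, Real.sign_neg]; ring
  rw [h2, integral_neg, this]; ring

lemma morawetz_meas {f g : ℝ → ℝ} (hf : Continuous f) (hg : Continuous g) :
    AEStronglyMeasurable (fun z : ℝ × ℝ => f z.1 * Real.sign (z.2 - z.1) * g z.2)
      (volume.prod volume) := by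
  refine Measurable.aestronglyMeasurable ?_
  refine Measurable.mul (Measurable.mul (by fun_prop) ?_) (by fun_prop)
  unfold Real.sign
  refine Measurable.ite (measurableSet_lt (by fun_prop) (by fun_prop)) (by fun_prop) ?_
  exact Measurable.ite (measurableSet_lt (by fun_prop) (by fun_prop)) (by fun_prop)
    (by fun_prop)

lemma morawetz_sign_le (x : ℝ) : |Real.sign x| ≤ 1 := by
  rcases Real.sign_apply_eq x with h | h | h <;> simp [h]

lemma morawetz_bound {a b C D s w v : ℝ} (ha : |a| ≤ C * w) (hb : |b| ≤ D * v) (hs : |s| ≤ 1) :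
    |a * s * b| ≤ (C * w) * (D * v) := by
  rw [abs_mul, abs_mul]
  have h0 : |a| * |s| ≤ C * w := (mul_le_of_le_one_right (abs_nonneg _) hs).trans ha
  exact mul_le_mul h0 hb (abs_nonneg _) ((abs_nonneg _).trans ha)

lemma morawetz_int {f g : ℝ → ℝ} (hf : MDec f) (hg : MDec g) :
    Integrable (fun z : ℝ × ℝ => f z.1 * Real.sign (z.2 - z.1) * g z.2)
      (volume.prod volume) := by
  obtain ⟨hfc, C, hC⟩ := hf
  obtain ⟨hgc, D, hD⟩ := hg
  refine Integrable.mono' ((integrable_inv_one_add_sq.const_mul C).mul_prod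
    (integrable_inv_one_add_sq.const_mul D)) (morawetz_meas hfc hgc)
    (Filter.Eventually.of_forall fun z => ?_)
  exact morawetz_bound (hC _) (hD _) (morawetz_sign_le _)

/-- The fixed-time double integral. -/
lemma morawetz_double {r P P' G G' : ℝ → ℝ} (hr : MDec r) (hP : MDec P) (hP' : MDec P')
    (hG : MDec G) (hG' : MDec G') (hdP : ∀ x, HasDerivAt P (P' x) x)
    (hdG : ∀ x, HasDerivAt G (G' x) x) :
    ∫ z : ℝ × ℝ, ((-2) * (P' z.1 * Real.sign (z.2 - z.1) * P z.2)
      + r z.1 * Real.sign (z.2 - z.1) * G' z.2) ∂(volume.prod volume)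
      = ∫ x, (-4 * (P x * P x) + -2 * (r x * G x)) := by
  have hPP : Integrable (fun x => P x * P x) := by
    obtain ⟨C, hC⟩ := hP.2
    refine hP.integrable.mul_bdd (c := C) hP.1.aestronglyMeasurable
      (Filter.Eventually.of_forall fun x => ?_)
    refine (hC x).trans ?_
    have hC0 : 0 ≤ C := by simpa using (abs_nonneg _).trans (hC 0)
    refine mul_le_of_le_one_right hC0 (inv_le_one_of_one_le₀ (by nlinarith [sq_nonneg x]))
  have hrG : Integrable (fun x => r x * G x) := by
    obtain ⟨C, hC⟩ := hG.2
    refine hr.integrable.mul_bdd (c := C) hG.1.aestronglyMeasurable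
      (Filter.Eventually.of_forall fun x => ?_)
    refine (hC x).trans ?_
    have hC0 : 0 ≤ C := by simpa using (abs_nonneg _).trans (hC 0)
    refine mul_le_of_le_one_right hC0 (inv_le_one_of_one_le₀ (by nlinarith [sq_nonneg x]))
  rw [integral_add ((morawetz_int hP' hP).const_mul _) (morawetz_int hr hG'),
    integral_const_mul, integral_prod_symm _ (morawetz_int hP' hP),
    integral_prod _ (morawetz_int hr hG'),
    integral_add (hPP.const_mul _) (hrG.const_mul _), integral_const_mul, integral_const_mul]
  simp only [integral_mul_const, morawetz_sgn_y hP hP' hdP]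
  simp only [mul_assoc, integral_const_mul,
    morawetz_sgn_x hG hG' hdG]
  have : ∀ x, r x * (-2 * G x) = -2 * (r x * G x) := fun x => by ring
  simp only [this, integral_const_mul]
  ring

/-- Quadratic decay in space, uniformly for times in `[-T, T]`. -/
def UDec {E : Type*} [NormedAddCommGroup E] (T : ℝ) (f : ℝ → ℝ → E) : Prop :=
  (∀ s, |s| ≤ T → Continuous (f s)) ∧
    ∃ C : ℝ, 0 ≤ C ∧ ∀ s, |s| ≤ T → ∀ x, ‖f s x‖ ≤ C * (1 + x ^ 2)⁻¹

lemma morawetz_w_le (x : ℝ) : (1 + x ^ 2)⁻¹ ≤ 1 :=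
  inv_le_one_of_one_le₀ (by nlinarith [sq_nonneg x])

lemma UDec.fixed {T : ℝ} {f : ℝ → ℝ → ℝ} (h : UDec T f) {s : ℝ} (hs : |s| ≤ T) : MDec (f s) := by
  obtain ⟨h1, C, _, hC⟩ := h
  exact ⟨h1 s hs, C, hC s hs⟩

section
variable {T : ℝ}

lemma UDec.re {f : ℝ → ℝ → ℂ} (h : UDec T f) : UDec T (fun s x => (f s x).re) := by
  obtain ⟨h1, C, h0, hC⟩ := h
  exact ⟨fun s hs => Complex.continuous_re.comp (h1 s hs), C, h0,
    fun s hs x => (Complex.abs_re_le_norm _).trans (hC s hs x)⟩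

lemma UDec.im {f : ℝ → ℝ → ℂ} (h : UDec T f) : UDec T (fun s x => (f s x).im) := by
  obtain ⟨h1, C, h0, hC⟩ := h
  exact ⟨fun s hs => Complex.continuous_im.comp (h1 s hs), C, h0,
    fun s hs x => (Complex.abs_im_le_norm _).trans (hC s hs x)⟩

lemma UDec.conj {f : ℝ → ℝ → ℂ} (h : UDec T f) :
    UDec T (fun s x => starRingEnd ℂ (f s x)) := by
  obtain ⟨h1, C, h0, hC⟩ := h
  exact ⟨fun s hs => Complex.continuous_conj.comp (h1 s hs), C, h0,
    fun s hs x => by simpa using hC s hs x⟩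

lemma UDec.norm {f : ℝ → ℝ → ℂ} (h : UDec T f) : UDec T (fun s x => ‖f s x‖) := by
  obtain ⟨h1, C, h0, hC⟩ := h
  exact ⟨fun s hs => (h1 s hs).norm, C, h0, fun s hs x => by simpa using hC s hs x⟩

lemma UDec.mul {R : Type*} [NormedRing R] {f g : ℝ → ℝ → R} (hf : UDec T f) (hg : UDec T g) :
    UDec T (fun s x => f s x * g s x) := by
  obtain ⟨h1, C, h0, hC⟩ := hf
  obtain ⟨k1, D, k0, hD⟩ := hg
  refine ⟨fun s hs => (h1 s hs).mul (k1 s hs), C * D, by positivity, fun s hs x => ?_⟩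
  refine (norm_mul_le _ _).trans ?_
  have : ‖f s x‖ ≤ C := (hC s hs x).trans (mul_le_of_le_one_right h0 (morawetz_w_le x))
  rw [mul_assoc]
  exact mul_le_mul this (hD s hs x) (norm_nonneg _) h0

lemma UDec.add {f g : ℝ → ℝ → ℝ} (hf : UDec T f) (hg : UDec T g) :
    UDec T (fun s x => f s x + g s x) := by
  obtain ⟨h1, C, h0, hC⟩ := hf
  obtain ⟨k1, D, k0, hD⟩ := hg
  refine ⟨fun s hs => (h1 s hs).add (k1 s hs), C + D, by positivity, fun s hs x => ?_⟩
  refine (norm_add_le _ _).trans ?_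
  rw [add_mul]
  exact add_le_add (hC s hs x) (hD s hs x)

lemma UDec.const_mul {f : ℝ → ℝ → ℝ} (c : ℝ) (hf : UDec T f) :
    UDec T (fun s x => c * f s x) := by
  obtain ⟨h1, C, h0, hC⟩ := hf
  refine ⟨fun s hs => continuous_const.mul (h1 s hs), |c| * C, by positivity, fun s hs x => ?_⟩
  rw [norm_mul, mul_assoc]
  exact mul_le_mul_of_nonneg_left (hC s hs x) (abs_nonneg _)

lemma UDec.sub {f g : ℝ → ℝ → ℝ} (hf : UDec T f) (hg : UDec T g) :
    UDec T (fun s x => f s x - g s x) := by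
  have := hf.add (hg.const_mul (-1))
  simpa [sub_eq_add_neg] using this

lemma UDec.rpow_mul {f : ℝ → ℝ → ℂ} {g : ℝ → ℝ → ℝ} {q : ℝ} (hq : 0 ≤ q)
    (hf : UDec T f) (hg : UDec T g) :
    UDec T (fun s x => ‖f s x‖ ^ q * g s x) := by
  obtain ⟨h1, C, h0, hC⟩ := hf
  obtain ⟨k1, D, k0, hD⟩ := hg
  refine ⟨fun s hs => ((h1 s hs).norm.rpow_const fun _ => Or.inr hq).mul (k1 s hs), C ^ q * D,
    by positivity, fun s hs x => ?_⟩
  have : ‖f s x‖ ≤ C := (hC s hs x).trans (mul_le_of_le_one_right h0 (morawetz_w_le x))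
  rw [norm_mul, mul_assoc, Real.norm_of_nonneg (by positivity)]
  exact mul_le_mul (Real.rpow_le_rpow (norm_nonneg _) this hq) (hD s hs x) (norm_nonneg _)
    (by positivity)

lemma UDec.rpow {f : ℝ → ℝ → ℂ} {q : ℝ} (hq : 0 ≤ q) (hf : UDec T f) :
    UDec T (fun s x => ‖f s x‖ ^ (q + 1)) := by
  have := hf.rpow_mul hq hf.norm
  have h2 : ∀ s x, ‖f s x‖ ^ (q + 1) = ‖f s x‖ ^ q * ‖f s x‖ := fun s x =>
    Real.rpow_add_one' (norm_nonneg _) (by positivity)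
  simpa only [h2] using this

end

lemma morawetz_hQ {a b : ℝ → ℂ} {a' b' : ℂ} {x : ℝ} (ha : HasDerivAt a a' x)
    (hb : HasDerivAt b b' x) :
    HasDerivAt (fun x => starRingEnd ℂ (a x) * b x)
      (starRingEnd ℂ a' * b x + starRingEnd ℂ (a x) * b') x :=
  ha.star.mul hb

lemma morawetz_hre {a : ℝ → ℂ} {a' : ℂ} {x : ℝ} (ha : HasDerivAt a a' x) :
    HasDerivAt (fun x => (a x).re) a'.re x :=
  Complex.reCLM.hasFDerivAt.comp_hasDerivAt x ha

lemma morawetz_him {a : ℝ → ℂ} {a' : ℂ} {x : ℝ} (ha : HasDerivAt a a' x) :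
    HasDerivAt (fun x => (a x).im) a'.im x :=
  Complex.imCLM.hasFDerivAt.comp_hasDerivAt x ha

lemma morawetz_normsq (z : ℂ) : ‖z‖ ^ 2 = z.re * z.re + z.im * z.im := by
  rw [Complex.sq_norm, Complex.normSq_apply]

lemma morawetz_hnorm {a : ℝ → ℂ} {a' : ℂ} {x : ℝ} (ha : HasDerivAt a a' x) :
    HasDerivAt (fun x => ‖a x‖ ^ 2) (2 * (starRingEnd ℂ (a x) * a').re) x := by
  have h := morawetz_hre (morawetz_hQ ha ha)
  have h2 : (fun x => ‖a x‖ ^ 2) = fun x => (starRingEnd ℂ (a x) * a x).re := by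
    funext x; rw [morawetz_normsq]; simp
  rw [h2]
  convert h using 1
  simp; ring

lemma morawetz_hrpow {a : ℝ → ℂ} {a' : ℂ} {x p : ℝ} (hp : 1 < p) (ha : HasDerivAt a a' x) :
    HasDerivAt (fun x => ‖a x‖ ^ (p + 1))
      ((p + 1) * (‖a x‖ ^ (p - 1) * (starRingEnd ℂ (a x) * a').re)) x := by
  have h := (hasFDerivAt_norm_rpow (a x) (p := p + 1) (by linarith)).comp_hasDerivAt x ha
  refine h.congr_deriv ?_
  have : p + 1 - 2 = p - 1 := by ring
  simp only [this, _root_.smul_apply, innerSL_apply_apply, smul_eq_mul,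
    Complex.inner]
  rw [mul_comm (a')]; ring

section
variable (p lam : ℝ) (a b c d : ℝ → ℂ)

/-- Momentum current. -/
def mwG (x : ℝ) : ℝ :=
  (starRingEnd ℂ (a x) * c x).re - ‖b x‖ ^ 2 - lam * ((p - 1) / (p + 1)) * ‖a x‖ ^ (p + 1)

/-- Derivative of the momentum current. -/
def mwG' (x : ℝ) : ℝ :=
  (starRingEnd ℂ (a x) * d x).re - (starRingEnd ℂ (b x) * c x).re
    - lam * (p - 1) * (‖a x‖ ^ (p - 1) * (starRingEnd ℂ (a x) * b x).re)

end

lemma mwG_hasDeriv {p lam : ℝ} (hp : 1 < p) {a b c d : ℝ → ℂ} {x : ℝ}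
    (ha : HasDerivAt a (b x) x) (hb : HasDerivAt b (c x) x) (hc : HasDerivAt c (d x) x) :
    HasDerivAt (mwG p lam a b c) (mwG' p lam a b c d x) x := by
  have h := ((morawetz_hre (morawetz_hQ ha hc)).sub (morawetz_hnorm hb)).sub
    ((morawetz_hrpow hp ha).const_mul (lam * ((p - 1) / (p + 1))))
  refine HasDerivAt.congr_deriv (f := mwG p lam a b c) h ?_
  have : p + 1 ≠ 0 := by linarith
  unfold mwG'
  simp only [Complex.add_re]
  field_simp
  ring

lemma mwG_udec {p lam T : ℝ} (hp : 1 < p) {a b c : ℝ → ℝ → ℂ} (ha : UDec T a) (hb : UDec T b)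
    (hc : UDec T c) : UDec T (fun s => mwG p lam (a s) (b s) (c s)) := by
  have h := ((ha.conj.mul hc).re.sub (hb.norm.mul hb.norm)).sub
    ((ha.rpow (q := p) (by linarith)).const_mul (lam * ((p - 1) / (p + 1))))
  simp only [← pow_two] at h
  exact h

lemma mwG'_udec {p lam T : ℝ} (hp : 1 < p) {a b c d : ℝ → ℝ → ℂ} (ha : UDec T a)
    (hb : UDec T b) (hc : UDec T c) (hd : UDec T d) :
    UDec T (fun s => mwG' p lam (a s) (b s) (c s) (d s)) :=
  ((ha.conj.mul hd).re.sub (hb.conj.mul hc).re).sub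
    ((ha.rpow_mul (q := p - 1) (by linarith) (ha.conj.mul hb).re).const_mul (lam * (p - 1)))

/-- Everything at a fixed time. -/
lemma morawetz_fixed {p lam T : ℝ} (hp : 1 < p) {a b c d : ℝ → ℝ → ℂ} (ha : UDec T a)
    (hb : UDec T b) (hc : UDec T c) (hd : UDec T d) {t : ℝ} (ht : |t| ≤ T)
    (hda : ∀ x, HasDerivAt (a t) (b t x) x) (hdb : ∀ x, HasDerivAt (b t) (c t x) x)
    (hdc : ∀ x, HasDerivAt (c t) (d t x) x) :
    ∫ z : ℝ × ℝ, ((-2) * ((starRingEnd ℂ (a t z.1) * c t z.1).im * Real.sign (z.2 - z.1) *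
          (starRingEnd ℂ (a t z.2) * b t z.2).im)
      + ‖a t z.1‖ ^ 2 * Real.sign (z.2 - z.1) * mwG' p lam (a t) (b t) (c t) (d t) z.2)
        ∂(volume.prod volume)
      = 2 * (∫ x : ℝ, (deriv (fun z => ‖a t z‖ ^ 2) x) ^ 2)
        + 2 * lam * ((p - 1) / (p + 1)) * (∫ x : ℝ, ‖a t x‖ ^ (p + 3)) := by
  have hr : UDec T (fun s x => ‖a s x‖ ^ 2) := by
    simpa only [← pow_two] using ha.norm.mul ha.norm
  have hR : UDec T (fun s x => (starRingEnd ℂ (a s x) * b s x).re) := (ha.conj.mul hb).re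
  have hP : UDec T (fun s x => (starRingEnd ℂ (a s x) * b s x).im) := (ha.conj.mul hb).im
  have hP' : UDec T (fun s x => (starRingEnd ℂ (a s x) * c s x).im) := (ha.conj.mul hc).im
  rw [morawetz_double (hr.fixed ht) (hP.fixed ht) (hP'.fixed ht)
    ((mwG_udec (lam := lam) hp ha hb hc).fixed ht)
    ((mwG'_udec (lam := lam) hp ha hb hc hd).fixed ht)
    (fun x => by
      convert morawetz_him (morawetz_hQ (hda x) (hdb x)) using 1
      simp; ring)
    (fun x => mwG_hasDeriv hp (hda x) (hdb x) (hdc x))]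
  have hder : ∀ x, deriv (fun z => ‖a t z‖ ^ 2) x = 2 * (starRingEnd ℂ (a t x) * b t x).re :=
    fun x => (morawetz_hnorm (hda x)).deriv
  simp only [hder]
  -- the exact derivative
  have hK : UDec T (fun s x => ‖a s x‖ ^ 2 * (starRingEnd ℂ (a s x) * b s x).re) := hr.mul hR
  have hb2 : UDec T (fun s x => ‖b s x‖ ^ 2) := by
    simpa only [← pow_two] using hb.norm.mul hb.norm
  have hK' : UDec T (fun s x => 2 * ((starRingEnd ℂ (a s x) * b s x).re *
      (starRingEnd ℂ (a s x) * b s x).re) + ‖a s x‖ ^ 2 * (‖b s x‖ ^ 2 +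
        (starRingEnd ℂ (a s x) * c s x).re)) :=
    ((hR.mul hR).const_mul 2).add (hr.mul (hb2.add (ha.conj.mul hc).re))
  have h0 := integral_of_hasDerivAt_of_tendsto (f := fun x => ‖a t x‖ ^ 2 *
      (starRingEnd ℂ (a t x) * b t x).re) (fun x => by
        refine HasDerivAt.congr_deriv ((morawetz_hnorm (hda x)).mul
          (morawetz_hre (morawetz_hQ (hda x) (hdb x)))) ?_
        · simp only [morawetz_normsq, Complex.add_re, Complex.mul_re, Complex.conj_re,
            Complex.conj_im]
          ring) (hK'.fixed ht).integrable (hK.fixed ht).tendsto_bot (hK.fixed ht).tendsto_top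
  have hR2 := ((hR.mul hR).fixed ht).integrable
  have hpp : UDec T (fun s x => ‖a s x‖ ^ (p + 3)) := by
    have := ha.rpow (q := p + 2) (by linarith)
    have e : p + 2 + 1 = p + 3 := by ring
    simpa only [e] using this
  have hpi := (hpp.fixed ht).integrable
  have key : ∀ x, -4 * ((starRingEnd ℂ (a t x) * b t x).im * (starRingEnd ℂ (a t x) * b t x).im)
      + -2 * (‖a t x‖ ^ 2 * mwG p lam (a t) (b t) (c t) x)
      = (8 * ((starRingEnd ℂ (a t x) * b t x).re * (starRingEnd ℂ (a t x) * b t x).re)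
        + 2 * lam * ((p - 1) / (p + 1)) * ‖a t x‖ ^ (p + 3))
        - 2 * (2 * ((starRingEnd ℂ (a t x) * b t x).re *
            (starRingEnd ℂ (a t x) * b t x).re) + ‖a t x‖ ^ 2 * (‖b t x‖ ^ 2 +
            (starRingEnd ℂ (a t x) * c t x).re)) := by
    intro x
    have e : ‖a t x‖ ^ (p + 3) = ‖a t x‖ ^ 2 * ‖a t x‖ ^ (p + 1) := by
      rw [show p + 3 = 2 + (p + 1) by ring, Real.rpow_add' (norm_nonneg _) (by linarith)]
      norm_num
    rw [e]
    unfold mwG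
    generalize ‖a t x‖ ^ (p + 1) = X
    simp only [morawetz_normsq, Complex.mul_re, Complex.mul_im, Complex.conj_re,
            Complex.conj_im]
    ring
  simp only [key]
  have hsum : Integrable (fun x => 8 * ((starRingEnd ℂ (a t x) * b t x).re *
      (starRingEnd ℂ (a t x) * b t x).re)
        + 2 * lam * ((p - 1) / (p + 1)) * ‖a t x‖ ^ (p + 3)) :=
    (hR2.const_mul _).add (hpi.const_mul _)
  rw [integral_sub hsum ((hK'.fixed ht).integrable.const_mul _),
    integral_add (hR2.const_mul _) (hpi.const_mul _), integral_const_mul, integral_const_mul,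
    integral_const_mul, h0]
  have : ∀ x, (2 * (starRingEnd ℂ (a t x) * b t x).re) ^ 2 =
    4 * ((starRingEnd ℂ (a t x) * b t x).re * (starRingEnd ℂ (a t x) * b t x).re) :=
    fun x => by ring
  simp only [this, integral_const_mul]
  ring

section
variable {p lam : ℝ} {u : ℝ → ℝ → ℂ}

lemma NLSSolution1.smooth_x (hu : NLSSolution1 p lam u) (s : ℝ) : ContDiff ℝ (⊤ : ℕ∞) (u s) :=
  hu.smooth.comp (contDiff_const.prodMk contDiff_id)

lemma NLSSolution1.hasDeriv_x (hu : NLSSolution1 p lam u) (k : ℕ) (s x : ℝ) :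
    HasDerivAt (iteratedDeriv k (u s)) (iteratedDeriv (k + 1) (u s) x) x := by
  rw [iteratedDeriv_succ]
  refine DifferentiableAt.hasDerivAt ?_
  exact ((hu.smooth_x s).differentiable_iteratedDeriv k
    (by exact_mod_cast WithTop.coe_lt_top _)) x

lemma NLSSolution1.udec (hu : NLSSolution1 p lam u) (T : ℝ) (k : ℕ) :
    UDec T (fun s => iteratedDeriv k (u s)) := by
  obtain ⟨C, hC⟩ := hu.decay k 0 T
  obtain ⟨D, hD⟩ := hu.decay k 2 T
  refine ⟨fun s _ => continuous_iff_continuousAt.2 fun x => (hu.hasDeriv_x k s x).continuousAt,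
    max (C + D) 0, le_max_right _ _, fun s hs x => ?_⟩
  have h1 := hC s hs x
  have h2 := hD s hs x
  rw [sq_abs] at h2
  have hpos : (0 : ℝ) < 1 + x ^ 2 := by positivity
  rw [← div_eq_mul_inv, le_div_iff₀ hpos]
  refine le_trans ?_ (le_max_left _ _)
  nlinarith

/-- Time derivative of `u`. -/
lemma NLSSolution1.hasDeriv_t (hu : NLSSolution1 p lam u) (s x : ℝ) :
    HasDerivAt (fun r => u r x) (deriv (fun r => u r x) s) s := by
  have : DifferentiableAt ℝ (fun r => u r x) s := by
    have h : ContDiff ℝ (⊤ : ℕ∞) (fun r => u r x) :=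
      hu.smooth.comp (contDiff_id.prodMk contDiff_const)
    exact h.differentiable (by simp) s
  exact this.hasDerivAt

/-- Mixed derivatives commute. -/
lemma NLSSolution1.mixed (hu : NLSSolution1 p lam u) (s x : ℝ) :
    ∃ m : ℂ, HasDerivAt (fun r => deriv (u r) x) m s ∧
      HasDerivAt (fun y => deriv (fun r => u r y) s) m x := by
  set f : ℝ × ℝ → ℂ := fun q => u q.1 q.2 with hf
  have hfd : Differentiable ℝ f := hu.smooth.differentiable (by simp)
  have hf' : ContDiff ℝ (⊤ : ℕ∞) (fderiv ℝ f) := hu.smooth.fderiv_right (by simp)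
  have hf'd : Differentiable ℝ (fderiv ℝ f) := hf'.differentiable (by simp)
  have hv : ∀ r y : ℝ, HasDerivAt (fun r => (r, y)) ((1 : ℝ), (0 : ℝ)) r := fun r y =>
    (hasDerivAt_id r).prodMk (hasDerivAt_const r y)
  have hw : ∀ r y : ℝ, HasDerivAt (fun y => (r, y)) ((0 : ℝ), (1 : ℝ)) y := fun r y =>
    (hasDerivAt_const y r).prodMk (hasDerivAt_id y)
  have h1 : ∀ r y, deriv (u r) y = fderiv ℝ f (r, y) (0, 1) := fun r y =>
    ((hfd (r, y)).hasFDerivAt.comp_hasDerivAt y (hw r y)).deriv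
  have h2 : ∀ r y, deriv (fun r => u r y) r = fderiv ℝ f (r, y) (1, 0) := by
    intro r y
    have h : HasDerivAt (f ∘ fun r => (r, y)) (fderiv ℝ f (r, y) (1, 0)) r :=
      (hfd (r, y)).hasFDerivAt.comp_hasDerivAt r (hv r y)
    exact h.deriv
  have hs : IsSymmSndFDerivAt ℝ f (s, x) :=
    hu.smooth.contDiffAt.isSymmSndFDerivAt (by
      rw [minSmoothness_of_isRCLikeNormedField]
      exact WithTop.coe_le_coe.2 le_top)
  refine ⟨fderiv ℝ (fderiv ℝ f) (s, x) (1, 0) (0, 1), ?_, ?_⟩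
  · simp only [h1]
    have := ((hf'd (s, x)).hasFDerivAt.comp_hasDerivAt s (hv s x))
    exact (this.clm_apply (hasDerivAt_const s ((0 : ℝ), (1 : ℝ)))).congr_deriv (by simp)
  · simp only [h2]
    rw [hs.eq]
    have := ((hf'd (s, x)).hasFDerivAt.comp_hasDerivAt x (hw s x))
    exact (this.clm_apply (hasDerivAt_const x ((1 : ℝ), (0 : ℝ)))).congr_deriv (by simp)

lemma NLSSolution1.eq' (hu : NLSSolution1 p lam u) (s x : ℝ) :
    deriv (fun r => u r x) s = Complex.I * (iteratedDeriv 2 (u s) x -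
      ((lam * ‖u s x‖ ^ (p - 1) : ℝ) : ℂ) * u s x) := by
  have h := hu.eq s x
  rw [iteratedDeriv_succ, iteratedDeriv_one]
  push_cast at h ⊢
  rw [← h]
  linear_combination (deriv (fun r => u r x) s) * Complex.I_mul_I

lemma NLSSolution1.rho_t (hu : NLSSolution1 p lam u) (s x : ℝ) :
    HasDerivAt (fun r => ‖u r x‖ ^ 2)
      (-2 * (starRingEnd ℂ (u s x) * iteratedDeriv 2 (u s) x).im) s := by
  refine (morawetz_hnorm (hu.hasDeriv_t s x)).congr_deriv ?_
  rw [hu.eq']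
  simp only [Complex.mul_re, Complex.mul_im, Complex.conj_re, Complex.conj_im, Complex.sub_re,
    Complex.sub_im, Complex.I_re, Complex.I_im, Complex.ofReal_re, Complex.ofReal_im]
  ring

lemma NLSSolution1.P_t (hp : 1 < p) (hu : NLSSolution1 p lam u) (s x : ℝ) :
    HasDerivAt (fun r => (starRingEnd ℂ (u r x) * deriv (u r) x).im)
      (mwG' p lam (u s) (deriv (u s)) (iteratedDeriv 2 (u s)) (iteratedDeriv 3 (u s)) x) s := by
  obtain ⟨m, hm1, hm2⟩ := hu.mixed s x
  refine (morawetz_him (morawetz_hQ (hu.hasDeriv_t s x) hm1)).congr_deriv ?_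
  have ha : HasDerivAt (u s) (deriv (u s) x) x := by
    simpa [iteratedDeriv_one] using hu.hasDeriv_x 0 s x
  have hc := hu.hasDeriv_x 2 s x
  -- the nonlinearity as a smooth function
  set w : ℝ → ℂ := fun y => Complex.I * deriv (fun r => u r y) s + iteratedDeriv 2 (u s) y with hw
  have hwd : HasDerivAt w (Complex.I * m + iteratedDeriv 3 (u s) x) x :=
    (hm2.const_mul Complex.I).add hc
  have hwe : ∀ y, w y = ((lam * ‖u s y‖ ^ (p - 1) : ℝ) : ℂ) * u s y := by
    intro y
    simp only [hw, hu.eq']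
    linear_combination (iteratedDeriv 2 (u s) y -
      ((lam * ‖u s y‖ ^ (p - 1) : ℝ) : ℂ) * u s y) * Complex.I_mul_I
  have h1 := morawetz_hre (morawetz_hQ ha hwd)
  have h2 := (morawetz_hrpow hp ha).const_mul lam
  have h3 : (fun y => (starRingEnd ℂ (u s y) * w y).re) = fun y => lam * ‖u s y‖ ^ (p + 1) := by
    funext y
    rw [hwe, show p + 1 = (p - 1) + 2 by ring, Real.rpow_add' (norm_nonneg _) (by linarith)]
    rw [Real.rpow_two, morawetz_normsq]
    simp only [Complex.mul_re, Complex.mul_im, Complex.conj_re, Complex.conj_im,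
      Complex.ofReal_re, Complex.ofReal_im]
    ring
  rw [h3] at h1
  have h4 := h1.unique h2
  rw [hwe] at h4
  rw [hu.eq']
  unfold mwG'
  generalize ‖u s x‖ ^ (p - 1) = g at *
  simp only [Complex.mul_re, Complex.mul_im, Complex.conj_re, Complex.conj_im, Complex.sub_re,
    Complex.sub_im, Complex.I_re, Complex.I_im, Complex.ofReal_re, Complex.ofReal_im,
    Complex.add_re, Complex.add_im] at h4 ⊢
  linear_combination (-1) * h4

end

/-- One-dimensional two-particle Morawetz identity. -/
theorem statement_8 (p lam : ℝ) (hp : 1 < p)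
    (u : ℝ → ℝ → ℂ) (hu : NLSSolution1 p lam u) (t : ℝ) :
    deriv (fun s => ∫ y : ℝ, ∫ x : ℝ,
        ‖u s y‖ ^ 2 * Real.sign (x - y) * (starRingEnd ℂ (u s x) * deriv (u s) x).im) t
      = 2 * (∫ x : ℝ, (deriv (fun z => ‖u t z‖ ^ 2) x) ^ 2)
        + 2 * lam * ((p - 1) / (p + 1)) * (∫ x : ℝ, ‖u t x‖ ^ (p + 3)) := by
  set T : ℝ := |t| + 1 with hT
  have ha : UDec T u := by simpa only [iteratedDeriv_zero] using hu.udec T 0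
  have hb : UDec T (fun s => deriv (u s)) := by
    simpa only [iteratedDeriv_one] using hu.udec T 1
  have hc := hu.udec T 2
  have hd := hu.udec T 3
  have ht : |t| ≤ T := by linarith
  have hr : UDec T (fun s x => ‖u s x‖ ^ 2) := by
    simpa only [← pow_two] using ha.norm.mul ha.norm
  have hP : UDec T (fun s x => (starRingEnd ℂ (u s x) * deriv (u s) x).im) := (ha.conj.mul hb).im
  have hP' : UDec T (fun s x => (starRingEnd ℂ (u s x) * iteratedDeriv 2 (u s) x).im) :=
    (ha.conj.mul hc).im
  have hG' := mwG'_udec (lam := lam) hp ha hb hc hd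
  have hnhds : Metric.ball t 1 ∈ nhds t := Metric.ball_mem_nhds t one_pos
  have hball : ∀ s ∈ Metric.ball t 1, |s| ≤ T := by
    intro s hs
    rw [Metric.mem_ball, Real.dist_eq] at hs
    have := abs_sub_abs_le_abs_sub s t
    linarith
  rw [← morawetz_fixed hp ha hb hc hd ht
    (fun x => by simpa [iteratedDeriv_one] using hu.hasDeriv_x 0 t x)
    (fun x => by simpa [iteratedDeriv_one] using hu.hasDeriv_x 1 t x)
    (fun x => hu.hasDeriv_x 2 t x)]
  have hev : (fun s => ∫ y : ℝ, ∫ x : ℝ,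
        ‖u s y‖ ^ 2 * Real.sign (x - y) * (starRingEnd ℂ (u s x) * deriv (u s) x).im)
      =ᶠ[nhds t] fun s => ∫ z : ℝ × ℝ, ‖u s z.1‖ ^ 2 * Real.sign (z.2 - z.1) *
        (starRingEnd ℂ (u s z.2) * deriv (u s) z.2).im ∂(volume.prod volume) := by
    filter_upwards [hnhds] with s hs
    rw [integral_prod _ (morawetz_int (hr.fixed (hball s hs)) (hP.fixed (hball s hs)))]
  rw [hev.deriv_eq]
  obtain ⟨C1, -, hC1⟩ := hr.2
  obtain ⟨C2, -, hC2⟩ := hP.2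
  obtain ⟨C3, -, hC3⟩ := hP'.2
  obtain ⟨C4, -, hC4⟩ := hG'.2
  refine (hasDerivAt_integral_of_dominated_loc_of_deriv_le
    (bound := fun z : ℝ × ℝ => 2 * ((C3 * (1 + z.1 ^ 2)⁻¹) * (C2 * (1 + z.2 ^ 2)⁻¹))
      + (C1 * (1 + z.1 ^ 2)⁻¹) * (C4 * (1 + z.2 ^ 2)⁻¹))
    (F' := fun s z => (-2) * ((starRingEnd ℂ (u s z.1) * iteratedDeriv 2 (u s) z.1).im *
        Real.sign (z.2 - z.1) * (starRingEnd ℂ (u s z.2) * deriv (u s) z.2).im)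
      + ‖u s z.1‖ ^ 2 * Real.sign (z.2 - z.1) *
        mwG' p lam (u s) (deriv (u s)) (iteratedDeriv 2 (u s)) (iteratedDeriv 3 (u s)) z.2)
    hnhds ?_ ?_ ?_ ?_ ?_ ?_).2.deriv
  · filter_upwards [hnhds] with s hs
    exact morawetz_meas (hr.1 s (hball s hs)) (hP.1 s (hball s hs))
  · exact morawetz_int (hr.fixed ht) (hP.fixed ht)
  · exact ((morawetz_meas (hP'.1 t ht) (hP.1 t ht)).const_mul (-2)).add
      (morawetz_meas (hr.1 t ht) (hG'.1 t ht))
  · refine Filter.Eventually.of_forall fun z s hs => ?_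
    have hs' := hball s hs
    refine (norm_add_le _ _).trans (add_le_add ?_
      (morawetz_bound (hC1 s hs' _) (hC4 s hs' _) (morawetz_sign_le _)))
    rw [norm_mul]
    have := morawetz_bound (hC3 s hs' z.1) (hC2 s hs' z.2) (morawetz_sign_le (z.2 - z.1))
    rw [norm_neg, Real.norm_two]
    exact mul_le_mul_of_nonneg_left this (by norm_num)
  · exact (((integrable_inv_one_add_sq.const_mul C3).mul_prod
      (integrable_inv_one_add_sq.const_mul C2)).const_mul 2).add
      ((integrable_inv_one_add_sq.const_mul C1).mul_prod
      (integrable_inv_one_add_sq.const_mul C4))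
  · refine Filter.Eventually.of_forall fun z s hs => ?_
    refine (((hu.rho_t s z.1).mul_const (Real.sign (z.2 - z.1))).mul
      (hu.P_t hp s z.2)).congr_deriv ?_
    ring
end
end
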